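/- Let p : Y → X be a preopfibration between small categories. The following are equivalent: (1) p is an opfibration; (2) p is a factorisation lifting; (3) the composite of any two composable weakly p-opcartesian morphisms in Y is weakly p-opcartesian. -/

import Mathlib

open CategoryTheory

universe u

variable {Y X : Type u} [Category.{u} Y] [Category.{u} X]

/-- A morphism `F : a ⟶ b` in `Y` is `p`-opcartesian if for every morphism `G : a ⟶ c` in `Y`
and every morphism `h : p.obj b ⟶ p.obj c` in `X` with `p.map F ≫ h = p.map G`, there is a
unique morphism `H : b ⟶ c` above `h` with `F ≫ H = G`. -/
def IsOpcartesian (p : Y ⥤ X) {a b : Y} (F : a ⟶ b) : Prop :=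
  ∀ ⦃c : Y⦄ (G : a ⟶ c) (h : p.obj b ⟶ p.obj c),
    p.map F ≫ h = p.map G → ∃! H : b ⟶ c, p.map H = h ∧ F ≫ H = G

/-- A morphism `F : a ⟶ b` above `f : x ⟶ y` is weakly `p`-opcartesian if every `G : a ⟶ c`
with `p.obj c = p.obj b` and `p G = p F` factors uniquely through `F` via a morphism above
the identity. -/
def IsWeaklyOpcartesian (p : Y ⥤ X) {a b : Y} (F : a ⟶ b) : Prop :=
  ∀ ⦃c : Y⦄ (G : a ⟶ c) (hc : p.obj c = p.obj b),
    p.map G = p.map F ≫ eqToHom hc.symm →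
      ∃! H : b ⟶ c, p.map H = eqToHom hc.symm ∧ F ≫ H = G

/-- `p` is an opfibration if every object `a` of `Y` and every morphism `f : p.obj a ⟶ y`
admit a `p`-opcartesian lifting above `f` with domain `a`. -/
def IsOpfibration (p : Y ⥤ X) : Prop :=
  ∀ (a : Y) ⦃y : X⦄ (f : p.obj a ⟶ y),
    ∃ (b : Y) (hb : p.obj b = y) (F : a ⟶ b),
      p.map F = f ≫ eqToHom hb.symm ∧ IsOpcartesian p F

/-- `p` is a preopfibration if every object `a` of `Y` and every morphism `f : p.obj a ⟶ y`
admit a weakly `p`-opcartesian lifting above `f` with domain `a`. -/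
def IsPreopfibration (p : Y ⥤ X) : Prop :=
  ∀ (a : Y) ⦃y : X⦄ (f : p.obj a ⟶ y),
    ∃ (b : Y) (hb : p.obj b = y) (F : a ⟶ b),
      p.map F = f ≫ eqToHom hb.symm ∧ IsWeaklyOpcartesian p F

/-- A factorisation of a morphism `F : a ⟶ c` lying above the composite `f ≫ g` into a
composable pair lying above `f` and `g` respectively. -/
structure FactThrough (p : Y ⥤ X) {a c : Y} (F : a ⟶ c) {m : X}
    (f : p.obj a ⟶ m) (g : m ⟶ p.obj c) where
  mid : Y
  mid_over : p.obj mid = m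
  left : a ⟶ mid
  right : mid ⟶ c
  left_over : p.map left = f ≫ eqToHom mid_over.symm
  right_over : p.map right = eqToHom mid_over ≫ g
  fact : left ≫ right = F

/-- A morphism of factorisations: a fibre morphism `H` between the middle objects with
`left ≫ H = left'` and `H ≫ right' = right`. -/
def FactRel (p : Y ⥤ X) {a c : Y} (F : a ⟶ c) {m : X} (f : p.obj a ⟶ m) (g : m ⟶ p.obj c)
    (s t : FactThrough p F f g) : Prop :=
  ∃ H : s.mid ⟶ t.mid, p.map H = eqToHom (s.mid_over.trans t.mid_over.symm) ∧
    s.left ≫ H = t.left ∧ H ≫ t.right = s.right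

/-- `p` is a factorisation lifting if every morphism above a composite factors accordingly,
uniquely up to a zigzag of fibre morphisms between factorisations. -/
def IsFactorisationLifting (p : Y ⥤ X) : Prop :=
  ∀ {a c : Y} (F : a ⟶ c) {m : X} (f : p.obj a ⟶ m) (g : m ⟶ p.obj c),
    p.map F = f ≫ g →
      Nonempty (FactThrough p F f g) ∧
        ∀ s t : FactThrough p F f g, Relation.EqvGen (FactRel p F f g) s t

/-- Under factorisation lifting, weakly opcartesian morphisms are opcartesian. -/
lemma opcart_of_factLift (p : Y ⥤ X) (h2 : IsFactorisationLifting p) {a b : Y} (F : a ⟶ b)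
    (hF : IsWeaklyOpcartesian p F) : IsOpcartesian p F := by
  intro c G h hG
  obtain ⟨⟨s⟩, hconn⟩ := h2 G (p.map F) h hG.symm
  have key : ∀ t : FactThrough p G (p.map F) h,
      ∃! H : b ⟶ t.mid, p.map H = eqToHom t.mid_over.symm ∧ F ≫ H = t.left :=
    fun t => hF t.left t.mid_over t.left_over
  have inv : ∀ s t : FactThrough p G (p.map F) h,
      Relation.EqvGen (FactRel p G (p.map F) h) s t →
      (key s).choose ≫ s.right = (key t).choose ≫ t.right := by
    intro s t hst
    induction hst with
    | rel s t hr =>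
      obtain ⟨K, hK, hl, hr⟩ := hr
      obtain ⟨h1, h2⟩ := (key s).choose_spec.1
      have : (key s).choose ≫ K = (key t).choose := by
        apply (key t).choose_spec.2
        constructor
        · rw [p.map_comp, h1, hK, eqToHom_trans]
        · rw [← Category.assoc, h2, hl]
      rw [← this, Category.assoc, hr]
    | refl s => rfl
    | symm s t _ ih => exact ih.symm
    | trans s t r _ _ ih1 ih2 => exact ih1.trans ih2
  obtain ⟨H, ⟨hH1, hH2⟩, -⟩ := key s
  refine ⟨H ≫ s.right, ⟨?_, ?_⟩, ?_⟩
  · rw [p.map_comp, hH1, s.right_over]; simp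
  · rw [← Category.assoc, hH2, s.fact]
  · have val : ∀ (t : FactThrough p G (p.map F) h) (H : b ⟶ t.mid),
        p.map H = eqToHom t.mid_over.symm → F ≫ H = t.left →
        (key t).choose ≫ t.right = H ≫ t.right := by
      intro t H h1 h2
      rw [(key t).choose_spec.2 H ⟨h1, h2⟩]
    rintro K ⟨hK1, hK2⟩
    let t : FactThrough p G (p.map F) h := ⟨b, rfl, F, K, by simp, by simp [hK1], hK2⟩
    have e1 := val t (𝟙 b) (by simp) (by simp [t])
    have e2 := val s H hH1 hH2
    have e3 := inv t s (hconn t s)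
    rw [e1, e2] at e3
    rw [← e3]
    simp [t]

/-- If weakly opcartesian morphisms compose, they are opcartesian. -/
lemma opcart_of_comp (p : Y ⥤ X) (hp : IsPreopfibration p)
    (h3 : ∀ {a b c : Y} (F : a ⟶ b) (G : b ⟶ c),
        IsWeaklyOpcartesian p F → IsWeaklyOpcartesian p G →
          IsWeaklyOpcartesian p (F ≫ G)) {a b : Y} (F : a ⟶ b)
    (hF : IsWeaklyOpcartesian p F) : IsOpcartesian p F := by
  intro c G h hG
  obtain ⟨d, hd, L, hL, hLw⟩ := hp b h
  obtain ⟨K, ⟨hK1, hK2⟩, hKu⟩ := h3 F L hF hLw G hd.symm (by simp [hL, ← hG])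
  refine ⟨L ≫ K, ⟨by simp [hL, hK1], by simpa using hK2⟩, ?_⟩
  rintro H ⟨hH1, hH2⟩
  obtain ⟨Kx, ⟨hKa, hKb⟩, -⟩ := hLw H hd.symm (by simp [hL, hH1])
  rw [← hKu Kx ⟨hKa, by rw [Category.assoc, hKb, hH2]⟩, hKb]

/-- An opfibration is a factorisation lifting. -/
lemma factLift_of_opfib (p : Y ⥤ X) (h1 : IsOpfibration p) : IsFactorisationLifting p := by
  intro a c F m f g hF
  obtain ⟨b, hb, L, hL, hLo⟩ := h1 a f
  obtain ⟨R, ⟨hR1, hR2⟩, hRu⟩ := hLo F (eqToHom hb ≫ g) (by simp [hL, hF])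
  let s₀ : FactThrough p F f g := ⟨b, hb, L, R, hL, hR1, hR2⟩
  have key : ∀ t, FactRel p F f g s₀ t := by
    intro t
    obtain ⟨H, ⟨hH1, hH2⟩, -⟩ := hLo t.left (eqToHom (hb.trans t.mid_over.symm))
      (by simp [hL, t.left_over])
    refine ⟨H, hH1, hH2, hRu _ ⟨by simp [hH1, t.right_over], ?_⟩⟩
    rw [← Category.assoc, hH2, t.fact]
  exact ⟨⟨s₀⟩, fun s t => .trans _ s₀ _ (.symm _ _ (.rel _ _ (key s))) (.rel _ _ (key t))⟩

/-- Opcartesian morphisms compose, and are weakly opcartesian. -/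
lemma weak_comp_of_opcart (p : Y ⥤ X) {a b c : Y} (F : a ⟶ b) (G : b ⟶ c)
    (hF : IsOpcartesian p F) (hG : IsOpcartesian p G) : IsWeaklyOpcartesian p (F ≫ G) := by
  intro d K hd hK
  obtain ⟨M, ⟨hM1, hM2⟩, hMu⟩ := hF K (p.map G ≫ eqToHom hd.symm) (by simp [hK])
  obtain ⟨N, ⟨hN1, hN2⟩, hNu⟩ := hG M (eqToHom hd.symm) hM1.symm
  refine ⟨N, ⟨hN1, by rw [Category.assoc, hN2, hM2]⟩, ?_⟩
  rintro Nx ⟨h1, h2⟩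
  exact hNu Nx ⟨h1, hMu _ ⟨by simp [h1], by simpa using h2⟩⟩

/-- For a preopfibration `p : Y ⥤ X` between small categories, the following are equivalent:
(1) `p` is an opfibration; (2) `p` is a factorisation lifting; (3) the composite of any two
composable weakly `p`-opcartesian morphisms is weakly `p`-opcartesian. -/
theorem preopfibration_tfae (p : Y ⥤ X) (hp : IsPreopfibration p) :
    [IsOpfibration p,
      IsFactorisationLifting p,
      ∀ {a b c : Y} (F : a ⟶ b) (G : b ⟶ c),
        IsWeaklyOpcartesian p F → IsWeaklyOpcartesian p G →
          IsWeaklyOpcartesian p (F ≫ G)].TFAE := by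
  have opf : (∀ {a b : Y} (F : a ⟶ b), IsWeaklyOpcartesian p F → IsOpcartesian p F) →
      IsOpfibration p := by
    intro h a y f
    obtain ⟨b, hb, F, hF, hw⟩ := hp a f
    exact ⟨b, hb, F, hF, h F hw⟩
  tfae_have 1 → 2 := factLift_of_opfib p
  tfae_have 2 → 3 := fun h2 a b c F G hF hG =>
    weak_comp_of_opcart p F G (opcart_of_factLift p h2 F hF) (opcart_of_factLift p h2 G hG)
  tfae_have 3 → 1 := fun h3 => opf (fun F hF => opcart_of_comp p hp h3 F hF)
  tfae_finish
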